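/- For every N ≥ 3, deleting the row and column indexed by (2,0) from the digraph Laplacian L yields det L_{(2,0)} = 2·det B_{N−1} − 3·det B_{N−2} − 3. -/

import Mathlib

/-- The `n×n` real tridiagonal matrix `B_n` with `3` on the diagonal and `−1` on the
first off-diagonals. -/
noncomputable def Bmat (n : ℕ) : Matrix (Fin n) (Fin n) ℝ :=
  Matrix.of fun i j =>
    if (i : ℕ) = (j : ℕ) then 3
    else if (i : ℕ) + 1 = (j : ℕ) ∨ (j : ℕ) + 1 = (i : ℕ) then -1
    else 0

/-- The digraph Laplacian `L` of the low-temperature two-ring ratchet, indexed by pairs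
`(i, n)` with `i : ZMod N` (site `N` is identified with `0`) and `n : Bool`
(`false` = outer ring `n = 0`, `true` = inner ring `n = 1`):
row `(1,0)` has diagonal `1` and `−1` in column `(1,1)`; row `(i,0)` for `2 ≤ i ≤ N−1`
has diagonal `1` and `−1` in column `(i−1,0)`; row `(N,0)` has diagonal `1` and `−1` in
column `(1,0)`; row `(i,1)` has diagonal `3` and `−1` in columns `(i−1,1)`, `(i+1,1)`
and `(i,0)`. -/
noncomputable def Lap (N : ℕ) : Matrix (ZMod N × Bool) (ZMod N × Bool) ℝ :=
  Matrix.of fun x y =>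
    if x.2 = false then
      if x.1 = 1 then
        (if y = x then 1 else if y = ((1 : ZMod N), true) then -1 else 0)
      else if x.1 = (N : ZMod N) then
        (if y = x then 1 else if y = ((1 : ZMod N), false) then -1 else 0)
      else
        (if y = x then 1 else if y = (x.1 - 1, false) then -1 else 0)
    else
      if y = x then 3
      else if y = (x.1 - 1, true) ∨ y = (x.1 + 1, true) ∨ y = (x.1, false) then -1
      else 0

/-- `L_x`: the `(2N−1)×(2N−1)` matrix obtained from the Laplacian `L` by deleting the
row and the column indexed by the state `x`. -/
noncomputable def Ldel (N : ℕ) [NeZero N] (x : ZMod N × Bool) :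
    Matrix {y : ZMod N × Bool // y ≠ x} {y : ZMod N × Bool // y ≠ x} ℝ :=
  (Lap N).submatrix Subtype.val Subtype.val

/-- The Schur complement of the outer block of `L_{(2,0)}` for `N = m + 3`, with sites numbered
from zero. -/
noncomputable def innerSchur (m : ℕ) : Matrix (Fin (m + 3)) (Fin (m + 3)) ℝ :=
  Matrix.of fun i j =>
    if (i : ℕ) = j then (if (i : ℕ) = 0 then 2 else 3)
    else if (i : ℕ) = m + 2 ∧ (j : ℕ) = 0 then -2
    else if (i : ℕ) + 1 = j ∨ (j : ℕ) + 1 = i ∨ ((i : ℕ) = 0 ∧ (j : ℕ) = m + 2) then -1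
    else 0

/-- The outer-to-outer block of `L_{(2,0)}` for `N = m + 3`, with sites numbered from zero. -/
noncomputable def outerBlock (m : ℕ) :
    Matrix {k : Fin (m + 3) // k ≠ 1} {k : Fin (m + 3) // k ≠ 1} ℝ :=
  Matrix.of fun k l =>
    if (k.1 : ℕ) = l.1 then 1
    else if ((k.1 : ℕ) = m + 2 ∧ (l.1 : ℕ) = 0) ∨
      ((k.1 : ℕ) ≠ m + 2 ∧ (l.1 : ℕ) + 1 = k.1) then -1
    else 0

/-- The outer-to-inner block of `L_{(2,0)}`. -/
noncomputable def outerInnerBlock (m : ℕ) : Matrix {k : Fin (m + 3) // k ≠ 1} (Fin (m + 3)) ℝ :=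
  Matrix.of fun k j => if (k.1 : ℕ) = 0 ∧ (j : ℕ) = 0 then -1 else 0

/-- The inner-to-outer block of `L_{(2,0)}`. -/
noncomputable def innerOuterBlock (m : ℕ) : Matrix (Fin (m + 3)) {k : Fin (m + 3) // k ≠ 1} ℝ :=
  Matrix.of fun i l => if (i : ℕ) = l.1 then -1 else 0

/-- The inner-to-inner block of `L_{(2,0)}`. -/
noncomputable def innerBlock (m : ℕ) : Matrix (Fin (m + 3)) (Fin (m + 3)) ℝ :=
  Matrix.of fun i j =>
    if (i : ℕ) = j then 3
    else if (i : ℕ) + 1 = j ∨ (j : ℕ) + 1 = i ∨ ((i : ℕ) = 0 ∧ (j : ℕ) = m + 2) ∨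
      ((i : ℕ) = m + 2 ∧ (j : ℕ) = 0) then -1
    else 0

/-- The solution `X` of `outerBlock * X + outerInnerBlock = 0`. -/
noncomputable def outerSolution (m : ℕ) : Matrix {k : Fin (m + 3) // k ≠ 1} (Fin (m + 3)) ℝ :=
  Matrix.of fun k j => if ((k.1 : ℕ) = 0 ∨ (k.1 : ℕ) = m + 2) ∧ (j : ℕ) = 0 then 1 else 0

lemma Fin.val_succAbove_eq_ite {n : ℕ} (p : Fin (n + 1)) (i : Fin n) :
    (p.succAbove i : ℕ) = if (i : ℕ) < p then (i : ℕ) else i + 1 := by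
  by_cases h : (i : ℕ) < p <;> simp [Fin.succAbove, Fin.lt_def, h]

lemma Fin.ne_one_iff_val {m : ℕ} (k : Fin (m + 3)) : k ≠ 1 ↔ (k : ℕ) ≠ 1 := by
  rw [Ne, Fin.ext_iff]; simp

lemma Fin.eq_add_one_iff_val {m : ℕ} (a b : Fin (m + 3)) :
    b = a + 1 ↔ ((b : ℕ) = a + 1 ∨ (b : ℕ) = 0 ∧ (a : ℕ) = m + 2) := by
  have := a.2
  have := b.2
  rw [Fin.ext_iff, Fin.val_add_one]
  split_ifs with h
  · rw [Fin.ext_iff, Fin.val_last] at h; omega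
  · rw [Fin.ext_iff, Fin.val_last] at h; omega

lemma det_eq_neg_one_pow_of_upper {n : ℕ} (M : Matrix (Fin n) (Fin n) ℝ)
    (hd : ∀ i, M i i = -1) (hu : ∀ i j, j < i → M i j = 0) : M.det = (-1) ^ n := by
  rw [Matrix.det_of_isUpperTriangular (fun i j h => hu i j h)]
  simp [hd]

lemma det_eq_neg_one_pow_of_lower {n : ℕ} (M : Matrix (Fin n) (Fin n) ℝ)
    (hd : ∀ i, M i i = -1) (hu : ∀ i j, i < j → M i j = 0) : M.det = (-1) ^ n := by
  rw [← Matrix.det_transpose]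
  exact det_eq_neg_one_pow_of_upper _ hd fun i j h => hu j i h

/-- Laplace expansion along a first row supported on the first and last columns. -/
lemma Matrix.det_of_first_row_ends {n : ℕ} (M : Matrix (Fin (n + 2)) (Fin (n + 2)) ℝ)
    (h : ∀ j : Fin n, M 0 j.castSucc.succ = 0) :
    M.det = M 0 0 * (M.submatrix Fin.succ Fin.succ).det
      + (-1) ^ (n + 1) * M 0 (Fin.last _) * (M.submatrix Fin.succ Fin.castSucc).det := by
  rw [Matrix.det_succ_row_zero, Fin.sum_univ_succ, Fin.sum_univ_castSucc,
    Finset.sum_eq_zero (fun j _ => by rw [h]; ring)]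
  simp [Fin.succAbove_zero, Fin.succ_last, Fin.succAbove_last]

lemma det_innerSchur_minor_last (m : ℕ) :
    ((innerSchur m).submatrix Fin.castSucc Fin.succ).det
      = (-1) ^ (m + 2) * (1 + (Bmat (m + 1)).det) := by
  rw [Matrix.det_of_first_row_ends]
  · have h1 : ((((innerSchur m).submatrix Fin.castSucc Fin.succ).submatrix
        Fin.succ Fin.succ)).det = (-1) ^ (m + 1) := by
      apply det_eq_neg_one_pow_of_lower
      · intro i
        have := i.2
        simp only [innerSchur, Matrix.submatrix_apply, Matrix.of_apply, Fin.val_succ,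
          Fin.val_castSucc]
        grind
      · intro i j hij
        have := j.2
        rw [Fin.lt_def] at hij
        simp only [innerSchur, Matrix.submatrix_apply, Matrix.of_apply, Fin.val_succ,
          Fin.val_castSucc]
        grind
    have h2 : ((((innerSchur m).submatrix Fin.castSucc Fin.succ).submatrix
        Fin.succ Fin.castSucc)) = Bmat (m + 1) := by
      ext i j
      have := i.2
      have := j.2
      simp only [innerSchur, Bmat, Matrix.submatrix_apply, Matrix.of_apply,
        Fin.val_succ, Fin.val_castSucc]
      grind
    rw [h1, h2]
    simp [innerSchur]
    ring
  · intro j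
    have := j.2
    simp only [innerSchur, Matrix.submatrix_apply, Matrix.of_apply,
      Fin.val_succ, Fin.val_castSucc, Fin.val_zero]
    grind

lemma det_innerSchur_minor_one (m : ℕ) :
    ((innerSchur m).submatrix (Fin.succAbove 1) Fin.succ).det
      = -(Bmat (m + 1)).det - 1 := by
  rw [Matrix.det_of_first_row_ends]
  · have h1 : ((((innerSchur m).submatrix (Fin.succAbove 1) Fin.succ).submatrix
        Fin.succ Fin.succ)) = Bmat (m + 1) := by
      ext i j
      have := i.2
      have := j.2
      simp only [innerSchur, Bmat, Matrix.submatrix_apply, Matrix.of_apply,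
        Fin.val_succAbove_eq_ite, Fin.val_succ, Fin.val_one]
      grind
    have h2 : ((((innerSchur m).submatrix (Fin.succAbove 1) Fin.succ).submatrix
        Fin.succ Fin.castSucc)).det = (-1) ^ (m + 1) := by
      apply det_eq_neg_one_pow_of_upper
      · intro i
        have := i.2
        simp only [innerSchur, Matrix.submatrix_apply, Matrix.of_apply,
          Fin.val_succAbove_eq_ite, Fin.val_succ, Fin.val_one, Fin.val_castSucc]
        grind
      · intro i j hij
        have := i.2
        rw [Fin.lt_def] at hij
        simp only [innerSchur, Matrix.submatrix_apply, Matrix.of_apply,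
          Fin.val_succAbove_eq_ite, Fin.val_succ, Fin.val_one, Fin.val_castSucc]
        grind
    rw [h1, h2]
    have h3 : ((-1 : ℝ) ^ (m + 1)) * (-1) ^ (m + 1) = 1 := by rw [← mul_pow]; simp
    simp [innerSchur]
    linear_combination -h3
  · intro j
    have := j.2
    simp only [innerSchur, Matrix.submatrix_apply, Matrix.of_apply,
      Fin.val_succAbove_eq_ite, Fin.val_succ, Fin.val_one, Fin.val_castSucc, Fin.val_zero]
    grind

lemma det_innerSchur (m : ℕ) :
    (innerSchur m).det = 2 * (Bmat (m + 2)).det - 3 * (Bmat (m + 1)).det - 3 := by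
  have h0 : (innerSchur m).submatrix Fin.succ Fin.succ = Bmat (m + 2) := by
    ext i j
    have := i.2
    have := j.2
    simp only [innerSchur, Bmat, Matrix.submatrix_apply, Matrix.of_apply, Fin.val_succ]
    grind
  have hz : ∀ i : Fin m, innerSchur m i.castSucc.succ.succ 0 = 0 := by
    intro i
    have := i.2
    simp only [innerSchur, Matrix.of_apply, Fin.val_succ, Fin.val_castSucc, Fin.val_zero]
    grind
  have e0 : innerSchur m 0 0 = 2 := by simp [innerSchur]
  have e1 : innerSchur m 1 0 = -1 := by simp [innerSchur]
  have e2 : innerSchur m (Fin.last (m + 2)) 0 = -2 := by simp [innerSchur]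
  rw [Matrix.det_succ_column_zero, Fin.sum_univ_succ, Fin.sum_univ_succ, Fin.sum_univ_castSucc,
    Finset.sum_eq_zero (fun i _ => by rw [hz]; ring)]
  rw [Fin.succ_zero_eq_one, Fin.succ_last, Fin.succ_last, Fin.succAbove_last]
  rw [show Fin.succAbove (0 : Fin (m + 3)) = Fin.succ from Fin.succAbove_zero]
  rw [h0, det_innerSchur_minor_last, det_innerSchur_minor_one, e0, e1, e2]
  have h3 : ((-1 : ℝ) ^ (m + 2)) * (-1) ^ (m + 2) = 1 := by rw [← mul_pow]; simp
  simp only [Fin.val_zero, Fin.val_one, Fin.val_last, Nat.succ_eq_add_one]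
  linear_combination (-2 * (1 + (Bmat (m + 1)).det)) * h3

lemma det_outerBlock (m : ℕ) : (outerBlock m).det = 1 := by
  rw [Matrix.det_of_isLowerTriangular]
  · simp [outerBlock]
  · intro k l h
    have h' : (k.1 : ℕ) < l.1 := h
    have := l.1.2
    have := k.1.2
    simp only [outerBlock, Matrix.of_apply]
    grind

lemma mul_outerSolution_apply {m : ℕ} {ι : Type*} (M : Matrix ι {k : Fin (m + 3) // k ≠ 1} ℝ)
    (i : ι) (j : Fin (m + 3)) :
    (M * outerSolution m) i j = if (j : ℕ) = 0 then
      M i ⟨0, by simp⟩ + M i ⟨Fin.last _, by simp [Fin.ne_one_iff_val]⟩ else 0 := by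
  rw [Matrix.mul_apply, Fintype.sum_eq_add ⟨0, by simp⟩
    ⟨Fin.last _, by simp [Fin.ne_one_iff_val]⟩]
  · by_cases h : (j : ℕ) = 0 <;> simp only [outerSolution, Matrix.of_apply, Fin.val_zero, Fin.val_last, h] <;> simp
  · simp [Fin.ext_iff]
  · rintro ⟨l, hl⟩ ⟨h1, h2⟩
    rw [Ne, Subtype.mk.injEq, Fin.ext_iff] at h1 h2
    rw [Fin.val_zero] at h1
    rw [Fin.val_last] at h2
    simp only [outerSolution, Matrix.of_apply, h1, h2, false_or, false_and, if_false, mul_zero]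

lemma outerBlock_mul_outerSolution (m : ℕ) :
    outerBlock m * outerSolution m + outerInnerBlock m = 0 := by
  ext ⟨k, hk⟩ j
  rw [Fin.ne_one_iff_val] at hk
  have := k.2
  rw [Matrix.add_apply, mul_outerSolution_apply]
  simp only [outerBlock, outerInnerBlock, Matrix.of_apply, Matrix.zero_apply, Fin.val_zero,
    Fin.val_last]
  grind

lemma innerOuterBlock_mul_outerSolution (m : ℕ) :
    innerOuterBlock m * outerSolution m + innerBlock m = innerSchur m := by
  ext i j
  have := i.2
  rw [Matrix.add_apply, mul_outerSolution_apply]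
  simp only [innerOuterBlock, innerBlock, innerSchur, Matrix.of_apply, Fin.val_zero, Fin.val_last]
  grind

lemma det_fromBlocks_eq_det_innerSchur (m : ℕ) :
    (Matrix.fromBlocks (outerBlock m) (outerInnerBlock m) (innerOuterBlock m)
      (innerBlock m)).det = (innerSchur m).det := by
  have h := congrArg Matrix.det (Matrix.fromBlocks_multiply (outerBlock m) (outerInnerBlock m)
    (innerOuterBlock m) (innerBlock m) 1 (outerSolution m) 0 1)
  simpa [outerBlock_mul_outerSolution, innerOuterBlock_mul_outerSolution, det_outerBlock,
    Matrix.det_fromBlocks_zero₁₂, Matrix.det_fromBlocks_zero₂₁] using h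

/-- The site `k + 1`, for `k` counted from zero. -/
def ringSite (m : ℕ) (k : Fin (m + 3)) : ZMod (m + 3) := (k + 1 : Fin (m + 3))

lemma ringSite_inj {m : ℕ} {a b : Fin (m + 3)} :
    ringSite m b = ringSite m a ↔ (a : ℕ) = b := by
  change b + 1 = a + 1 ↔ _
  rw [add_left_inj, Fin.ext_iff, eq_comm]

lemma ringSite_eq_one {m : ℕ} {a : Fin (m + 3)} : ringSite m a = 1 ↔ (a : ℕ) = 0 := by
  change a + 1 = 1 ↔ _
  rw [add_eq_right, Fin.ext_iff, Fin.val_zero]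

lemma ringSite_eq_two {m : ℕ} {a : Fin (m + 3)} : ringSite m a = 2 ↔ a = 1 := by
  rw [← one_add_one_eq_two]
  change a + 1 = 1 + 1 ↔ _
  rw [add_left_inj]

lemma ringSite_eq_natCast {m : ℕ} {a : Fin (m + 3)} :
    ringSite m a = ((m + 3 : ℕ) : ZMod (m + 3)) ↔ (a : ℕ) = m + 2 := by
  rw [ZMod.natCast_self]
  change a + 1 = 0 ↔ _
  rw [eq_comm, Fin.eq_add_one_iff_val, Fin.val_zero]
  omega

lemma ringSite_eq_sub_one {m : ℕ} {a b : Fin (m + 3)} :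
    ringSite m b = ringSite m a - 1 ↔ ((a : ℕ) = b + 1 ∨ (a : ℕ) = 0 ∧ (b : ℕ) = m + 2) := by
  change b + 1 = a + 1 - 1 ↔ _
  rw [add_sub_cancel_right, eq_comm, Fin.eq_add_one_iff_val]

lemma ringSite_eq_add_one {m : ℕ} {a b : Fin (m + 3)} :
    ringSite m b = ringSite m a + 1 ↔ ((b : ℕ) = a + 1 ∨ (b : ℕ) = 0 ∧ (a : ℕ) = m + 2) := by
  change b + 1 = a + 1 + 1 ↔ _
  rw [add_left_inj, Fin.eq_add_one_iff_val]

lemma ringSite_bijective (m : ℕ) : Function.Bijective (ringSite m) :=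
  (Equiv.addRight (1 : Fin (m + 3))).bijective

/-- The states other than `(2,0)`, split into outer and inner sites numbered from zero. -/
noncomputable def stateEquiv (m : ℕ) : {k : Fin (m + 3) // k ≠ 1} ⊕ Fin (m + 3) ≃
    {y : ZMod (m + 3) × Bool // y ≠ (2, false)} :=
  Equiv.ofBijective
    (Sum.elim
      (fun k => ⟨(ringSite m k, false), fun h => k.2 (ringSite_eq_two.1 (Prod.ext_iff.1 h).1)⟩)
      (fun k => ⟨(ringSite m k, true), by simp⟩)) (by
    constructor
    · rintro (⟨a, ha⟩ | a) (⟨b, hb⟩ | b) h <;>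
        simp_all [(ringSite_bijective m).1.eq_iff]
    · rintro ⟨⟨a, b⟩, h⟩
      obtain ⟨k, rfl⟩ := (ringSite_bijective m).2 a
      cases b
      · exact ⟨Sum.inl ⟨k, fun hk => h (by rw [ringSite_eq_two.2 hk])⟩, rfl⟩
      · exact ⟨Sum.inr k, rfl⟩)

lemma Lap_ringSite_false (m : ℕ) (a : Fin (m + 3)) (y : ZMod (m + 3) × Bool) :
    Lap (m + 3) (ringSite m a, false) y =
      if ringSite m a = 1 then
        (if y = (ringSite m a, false) then 1 else if y = (1, true) then -1 else 0)
      else if ringSite m a = ((m + 3 : ℕ) : ZMod (m + 3)) then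
        (if y = (ringSite m a, false) then 1 else if y = (1, false) then -1 else 0)
      else
        (if y = (ringSite m a, false) then 1
          else if y = (ringSite m a - 1, false) then -1 else 0) :=
  rfl

lemma Lap_ringSite_true (m : ℕ) (a : Fin (m + 3)) (y : ZMod (m + 3) × Bool) :
    Lap (m + 3) (ringSite m a, true) y =
      if y = (ringSite m a, true) then 3
      else if y = (ringSite m a - 1, true) ∨ y = (ringSite m a + 1, true) ∨
        y = (ringSite m a, false) then -1
      else 0 :=
  rfl

lemma Ldel_submatrix_stateEquiv (m : ℕ) :
    (Ldel (m + 3) (2, false)).submatrix (stateEquiv m) (stateEquiv m)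
      = Matrix.fromBlocks (outerBlock m) (outerInnerBlock m) (innerOuterBlock m)
          (innerBlock m) := by
  ext (k | k) (l | l)
  · have h1 := (Fin.ne_one_iff_val _).1 k.2
    have h2 := (Fin.ne_one_iff_val _).1 l.2
    change Lap (m + 3) (ringSite m k, false) (ringSite m l, false) = outerBlock m k l
    simp only [Lap_ringSite_false, outerBlock, Matrix.of_apply, Prod.mk.injEq, ringSite_inj,
      ringSite_eq_one, ringSite_eq_natCast, ringSite_eq_sub_one]
    grind
  · have h1 := (Fin.ne_one_iff_val _).1 k.2
    change Lap (m + 3) (ringSite m k, false) (ringSite m l, true) = outerInnerBlock m k l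
    simp only [Lap_ringSite_false, outerInnerBlock, Matrix.of_apply, Prod.mk.injEq, ringSite_inj,
      ringSite_eq_one, ringSite_eq_natCast, ringSite_eq_sub_one]
    grind
  · change Lap (m + 3) (ringSite m k, true) (ringSite m l, false) = innerOuterBlock m k l
    simp only [Lap_ringSite_true, innerOuterBlock, Matrix.of_apply, Prod.mk.injEq, ringSite_inj,
      ringSite_eq_add_one, ringSite_eq_sub_one]
    grind
  · change Lap (m + 3) (ringSite m k, true) (ringSite m l, true) = innerBlock m k l
    simp only [Lap_ringSite_true, innerBlock, Matrix.of_apply, Prod.mk.injEq, ringSite_inj,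
      ringSite_eq_add_one, ringSite_eq_sub_one]
    grind

/-- Deleting the row and column indexed by `(2,0)` from the digraph Laplacian yields
`det L_{(2,0)} = 2·det B_{N−1} − 3·det B_{N−2} − 3`. -/
theorem det_Ldel_two_outer (N : ℕ) [NeZero N] (hN : 3 ≤ N) :
    (Ldel N ((2 : ZMod N), false)).det
      = 2 * (Bmat (N - 1)).det - 3 * (Bmat (N - 2)).det - 3 := by
  obtain ⟨m, rfl⟩ := Nat.exists_eq_add_of_le' hN
  rw [← Matrix.det_submatrix_equiv_self (stateEquiv m), Ldel_submatrix_stateEquiv,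
    det_fromBlocks_eq_det_innerSchur, det_innerSchur]
  rfl
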